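/- If M = (C1 C2)³ or M = (C2 C1)³, then ‖Mᵀ‖_D^{M ℝ³_{≥0}} ≤ 4/5; that is, sup over nonzero f ∈ M ℝ³_{≥0} and nonzero z ∈ f^⊥ of ‖Mᵀ z‖_D / ‖z‖_D is at most 4/5. -/

import Mathlib

open Matrix Filter MeasureTheory

noncomputable section

/-- The matrix `C1`. -/
def C1 : Matrix (Fin 3) (Fin 3) ℝ := !![1,1,0; 0,0,1; 0,1,0]

/-- The matrix `C2`. -/
def C2 : Matrix (Fin 3) (Fin 3) ℝ := !![0,1,0; 1,0,0; 0,1,1]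

/-- The seminorm `max(v) - min(v)` on `ℝ³`. -/
def normD (v : Fin 3 → ℝ) : ℝ :=
  max (v 0) (max (v 1) (v 2)) - min (v 0) (min (v 1) (v 2))

/-- The matrix seminorm associated with `normD` and a cone `Λ`:
the sup over nonzero `f ∈ Λ` and nonzero `z ⊥ f` of `normD (M z) / normD z`. -/
def matSemiNormD (M : Matrix (Fin 3) (Fin 3) ℝ) (Λ : Set (Fin 3 → ℝ)) : ℝ :=
  sSup {r : ℝ | ∃ f ∈ Λ, f ≠ 0 ∧
    ∃ z : Fin 3 → ℝ, z ≠ 0 ∧ (∑ i, z i * f i) = 0 ∧ r = normD (M.mulVec z) / normD z}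

/-- The image of the nonnegative orthant under `M`. -/
def cone (M : Matrix (Fin 3) (Fin 3) ℝ) : Set (Fin 3 → ℝ) :=
  {y | ∃ x : Fin 3 → ℝ, (∀ i, 0 ≤ x i) ∧ y = M.mulVec x}

/-- The ray generated by `f`. -/
def ray (f : Fin 3 → ℝ) : Set (Fin 3 → ℝ) := {y | ∃ t : ℝ, 0 ≤ t ∧ y = t • f}

/-- A vector orthogonal to a nonzero nonnegative vector has a nonnegative entry. -/
lemma exists_nonneg_of_orthogonal {ι : Type*} [Fintype ι] {x w : ι → ℝ} (hx : ∀ i, 0 ≤ x i)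
    (hx0 : x ≠ 0) (h : ∑ i, x i * w i = 0) : ∃ i, 0 ≤ w i := by
  by_contra! hw
  refine hx0 (funext fun i => ?_)
  have hi := (Finset.sum_eq_zero_iff_of_nonpos
    fun i _ => mul_nonpos_of_nonneg_of_nonpos (hx i) (hw i).le).1 h i (Finset.mem_univ i)
  exact (mul_eq_zero.1 hi).resolve_right (hw i).ne

/-- A vector orthogonal to a nonzero nonnegative vector has a nonpositive entry. -/
lemma exists_nonpos_of_orthogonal {ι : Type*} [Fintype ι] {x w : ι → ℝ} (hx : ∀ i, 0 ≤ x i)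
    (hx0 : x ≠ 0) (h : ∑ i, x i * w i = 0) : ∃ i, w i ≤ 0 := by
  obtain ⟨i, hi⟩ := exists_nonneg_of_orthogonal (w := -w) hx hx0 (by simpa using h)
  exact ⟨i, by simpa using hi⟩

lemma sub_le_normD (v : Fin 3 → ℝ) (i j : Fin 3) : v i - v j ≤ normD v := by
  unfold normD
  apply sub_le_sub <;> [fin_cases i; fin_cases j] <;> simp

lemma normD_le_of_forall_sub_le {v : Fin 3 → ℝ} {c : ℝ} (h : ∀ i j, v i - v j ≤ c) :
    normD v ≤ c := by
  have hmin (a : ℝ) (ha : ∀ j, a - v j ≤ c) : a - c ≤ min (v 0) (min (v 1) (v 2)) :=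
    le_min (by linarith [ha 0]) (le_min (by linarith [ha 1]) (by linarith [ha 2]))
  have hmax : max (v 0) (max (v 1) (v 2)) ≤ c + min (v 0) (min (v 1) (v 2)) :=
    max_le (by linarith [hmin _ (h 0)])
      (max_le (by linarith [hmin _ (h 1)]) (by linarith [hmin _ (h 2)]))
  unfold normD
  linarith

/-- To bound `matSemiNormD Mᵀ (cone M)`, it suffices to consider the vectors `z` such that `Mᵀ z`
is not of strict sign. -/
lemma matSemiNormD_transpose_cone_le {M : Matrix (Fin 3) (Fin 3) ℝ} {c : ℝ} (hc : 0 ≤ c)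
    (h : ∀ (z : Fin 3 → ℝ) (k l i j : Fin 3), 0 ≤ (Mᵀ *ᵥ z) k → (Mᵀ *ᵥ z) l ≤ 0 →
      (Mᵀ *ᵥ z) i - (Mᵀ *ᵥ z) j ≤ c * normD z) :
    matSemiNormD Mᵀ (cone M) ≤ c := by
  refine Real.sSup_le ?_ hc
  rintro r ⟨f, ⟨x, hx, rfl⟩, hf, z, -, hz, rfl⟩
  have hx0 : x ≠ 0 := by
    rintro rfl
    simp at hf
  have hxz : ∑ i, x i * (Mᵀ *ᵥ z) i = 0 := by
    change x ⬝ᵥ (Mᵀ *ᵥ z) = 0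
    rw [Matrix.mulVec_transpose, dotProduct_comm, ← Matrix.dotProduct_mulVec]
    exact hz
  obtain ⟨k, hk⟩ := exists_nonneg_of_orthogonal hx hx0 hxz
  obtain ⟨l, hl⟩ := exists_nonpos_of_orthogonal hx hx0 hxz
  have hz0 : 0 ≤ normD z := by simpa using sub_le_normD z 0 0
  exact div_le_of_le_mul₀ hz0 hc (normD_le_of_forall_sub_le fun i j => h z k l i j hk hl)

lemma C1_mul_C2_pow_three : (C1 * C2) ^ 3 = !![2, 3, 2; 2, 2, 1; 1, 2, 1] := by
  norm_num [C1, C2, pow_succ, Matrix.mul_fin_three]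

lemma C2_mul_C1_pow_three : (C2 * C1) ^ 3 = !![1, 2, 1; 1, 2, 2; 2, 3, 2] := by
  norm_num [C1, C2, pow_succ, Matrix.mul_fin_three]

theorem contracting_matrix (M : Matrix (Fin 3) (Fin 3) ℝ)
    (hM : M = (C1 * C2) ^ 3 ∨ M = (C2 * C1) ^ 3) :
    matSemiNormD Mᵀ (cone M) ≤ 4 / 5 := by
  refine matSemiNormD_transpose_cone_le (by norm_num) fun z k l i j hk hl => ?_
  have h01 := sub_le_normD z 0 1
  have h10 := sub_le_normD z 1 0
  have h02 := sub_le_normD z 0 2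
  have h20 := sub_le_normD z 2 0
  have h12 := sub_le_normD z 1 2
  have h21 := sub_le_normD z 2 1
  have hw : Mᵀ *ᵥ z = ![2 * z 0 + 2 * z 1 + z 2, 3 * z 0 + 2 * z 1 + 2 * z 2,
        2 * z 0 + z 1 + z 2] ∨
      Mᵀ *ᵥ z = ![z 0 + z 1 + 2 * z 2, 2 * z 0 + 2 * z 1 + 3 * z 2,
        z 0 + 2 * z 1 + 2 * z 2] := by
    refine hM.imp ?_ ?_ <;> rintro rfl <;> ext i <;> fin_cases i <;>
      simp [C1_mul_C2_pow_three, C2_mul_C1_pow_three, Matrix.mulVec, dotProduct,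
        Fin.sum_univ_three]
  rcases hw with hw | hw <;> rw [hw] at hk hl ⊢ <;> fin_cases k <;> fin_cases l <;>
    simp only [Fin.zero_eta, Fin.mk_one, Fin.reduceFinMk, Matrix.cons_val] at hk hl <;>
    fin_cases i <;> fin_cases j <;>
    simp only [Fin.zero_eta, Fin.mk_one, Fin.reduceFinMk, Matrix.cons_val] <;>
    linarith
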